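/- Let d ≥ 1, let T ⊆ ℝ^d be an open set with nonempty complement, let 0 < a < 1, let 0 < q < ∞ and let σ ∈ ℝ. Then there is a constant C > 1, depending only on d, a, q and σ, such that for every measurable function H on T: C⁻¹ ‖H‖_{L^{q,σ}_{av}(T)}^q ≤ ∫_T ( ⨍_{B(x, a·d(x))} |H(y)|² dy )^{q/2} d(x)^{q−1−qσ} dx ≤ C ‖H‖_{L^{q,σ}_{av}(T)}^q. In other words, changing the aperture of the Whitney balls from 1/2 to any a ∈ (0,1) yields a comparable weighted averaged norm. -/

import Mathlib

open MeasureTheory Metric Set ENNReal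

noncomputable section

/-- `wdist Ω x = dist(x, ℝ^d ∖ Ω)`. -/
def wdist {d : ℕ} (Ω : Set (EuclideanSpace ℝ (Fin d))) (x : EuclideanSpace ℝ (Fin d)) : ℝ :=
  Metric.infDist x Ωᶜ

/-- The weighted averaged norm `‖H‖_{L^{q,σ}_{av}(Ω)}`. -/
def avNorm {d : ℕ} {F : Type*} [NormedAddCommGroup F] (q σ : ℝ)
    (Ω : Set (EuclideanSpace ℝ (Fin d))) (H : EuclideanSpace ℝ (Fin d) → F) : ℝ≥0∞ :=
  (∫⁻ x in Ω,
      ((volume (Metric.ball x (wdist Ω x / 2)))⁻¹ *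
          ∫⁻ y in Metric.ball x (wdist Ω x / 2), (‖H y‖₊ : ℝ≥0∞) ^ (2 : ℕ)) ^ (q / 2) *
        ENNReal.ofReal (wdist Ω x) ^ (q - 1 - q * σ)) ^ (1 / q)

/-- An antilipschitz self-map increases the volume of preimages by a bounded factor only. -/
theorem AntilipschitzWith.volume_preimage_le {d : ℕ} {K : NNReal}
    {f : EuclideanSpace ℝ (Fin d) → EuclideanSpace ℝ (Fin d)} (hf : AntilipschitzWith K f)
    (s : Set (EuclideanSpace ℝ (Fin d))) :
    volume (f ⁻¹' s) ≤ (K : ℝ≥0∞) ^ d * volume s := by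
  have hvol := Measure.isAddLeftInvariant_eq_smul
    (volume : Measure (EuclideanSpace ℝ (Fin d)))
    (Measure.hausdorffMeasure (Module.finrank ℝ (EuclideanSpace ℝ (Fin d)) : ℝ))
  have h := hf.hausdorffMeasure_preimage_le
    (Nat.cast_nonneg (Module.finrank ℝ (EuclideanSpace ℝ (Fin d)))) s
  rw [hvol, Measure.smul_apply, Measure.smul_apply, ENNReal.smul_def, ENNReal.smul_def,
    smul_eq_mul, smul_eq_mul, mul_left_comm]
  refine mul_le_mul_right (h.trans_eq ?_) _
  rw [ENNReal.rpow_natCast, finrank_euclideanSpace_fin]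

theorem AntilipschitzWith.lintegral_comp_le {d : ℕ} {K : NNReal}
    {f : EuclideanSpace ℝ (Fin d) → EuclideanSpace ℝ (Fin d)} (hf : AntilipschitzWith K f)
    (hfm : Measurable f) {g : EuclideanSpace ℝ (Fin d) → ℝ≥0∞} (hg : Measurable g) :
    ∫⁻ x, g (f x) ≤ (K : ℝ≥0∞) ^ d * ∫⁻ x, g x := by
  rw [← lintegral_map hg hfm, ← smul_eq_mul, ← lintegral_smul_measure]
  refine lintegral_mono' (Measure.le_iff.2 fun s hs => ?_) le_rfl
  rw [Measure.map_apply hfm hs]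
  exact hf.volume_preimage_le s

theorem ENNReal.sum_rpow_le_card_rpow_mul_sum_rpow {ι : Type*} (s : Finset ι) (f : ι → ℝ≥0∞)
    {p : ℝ} (hp : 0 < p) :
    (∑ i ∈ s, f i) ^ p ≤ (s.card : ℝ≥0∞) ^ p * ∑ i ∈ s, f i ^ p := by
  rcases s.eq_empty_or_nonempty with rfl | hs
  · simp [hp]
  obtain ⟨j, hj, hmax⟩ := s.exists_max_image f hs
  calc (∑ i ∈ s, f i) ^ p ≤ (s.card * f j) ^ p := by
        gcongr
        simpa using Finset.sum_le_card_nsmul s f (f j) hmax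
    _ = (s.card : ℝ≥0∞) ^ p * f j ^ p := ENNReal.mul_rpow_of_nonneg _ _ hp.le
    _ ≤ _ := by
        gcongr
        exact Finset.single_le_sum (f := fun i => f i ^ p) (fun _ _ => zero_le) hj

theorem setLIntegral_biUnion_finset_le {α ι : Type*} [MeasurableSpace α] {μ : Measure α}
    (s : Finset ι) (t : ι → Set α) (f : α → ℝ≥0∞) :
    ∫⁻ x in ⋃ i ∈ s, t i, f x ∂μ ≤ ∑ i ∈ s, ∫⁻ x in t i, f x ∂μ := by
  have h := lintegral_iUnion_le (μ := μ) (fun i : s => t i) f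
  rw [tsum_fintype, Finset.sum_coe_sort s fun i => ∫⁻ x in t i, f x ∂μ] at h
  rwa [iUnion_subtype] at h

theorem measurable_setLIntegral_ball {X : Type*} [PseudoMetricSpace X] [MeasurableSpace X]
    [OpensMeasurableSpace X] [SecondCountableTopology X] {μ : Measure X} [SFinite μ]
    {r : X → ℝ} (hr : Measurable r) {g : X → ℝ≥0∞} (hg : Measurable g) :
    Measurable fun x => ∫⁻ y in ball x (r x), g y ∂μ := by
  have hs : MeasurableSet {z : X × X | dist z.2 z.1 < r z.1} :=
    measurableSet_lt (measurable_snd.dist measurable_fst) (hr.comp measurable_fst)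
  have h := ((hg.comp measurable_snd).indicator hs).lintegral_prod_right' (ν := μ)
  simp_rw [← lintegral_indicator measurableSet_ball]
  exact h

theorem wdist_pos {d : ℕ} {T : Set (EuclideanSpace ℝ (Fin d))} (hT : IsOpen T)
    (hTc : Tᶜ.Nonempty) {x : EuclideanSpace ℝ (Fin d)} (hx : x ∈ T) : 0 < wdist T x :=
  (hT.isClosed_compl.notMem_iff_infDist_pos hTc).1 (not_not.2 hx)

theorem lipschitzWith_wdist {d : ℕ} (T : Set (EuclideanSpace ℝ (Fin d))) :
    LipschitzWith 1 (wdist T) :=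
  lipschitz_infDist_pt _

theorem abs_wdist_sub_le {d : ℕ} (T : Set (EuclideanSpace ℝ (Fin d)))
    (x y : EuclideanSpace ℝ (Fin d)) : |wdist T x - wdist T y| ≤ dist x y := by
  simpa [Real.dist_eq] using (lipschitzWith_wdist T).dist_le_mul x y

theorem measurable_wdist {d : ℕ} (T : Set (EuclideanSpace ℝ (Fin d))) : Measurable (wdist T) :=
  (lipschitzWith_wdist T).continuous.measurable

theorem wdist_nonneg {d : ℕ} (T : Set (EuclideanSpace ℝ (Fin d)))
    (x : EuclideanSpace ℝ (Fin d)) : 0 ≤ wdist T x :=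
  infDist_nonneg

theorem antilipschitzWith_add_wdist_smul {d : ℕ} (T : Set (EuclideanSpace ℝ (Fin d))) {a : ℝ}
    (ha : a < 1) {z : EuclideanSpace ℝ (Fin d)} (hz : ‖z‖ ≤ a) :
    AntilipschitzWith (1 - a)⁻¹.toNNReal fun x => x + wdist T x • z := by
  refine AntilipschitzWith.of_le_mul_dist fun x y => ?_
  have h1 : 0 < 1 - a := by linarith
  rw [Real.coe_toNNReal _ (inv_nonneg.2 h1.le), inv_mul_eq_div, le_div_iff₀ h1]
  have h2 : x - y = (x + wdist T x • z - (y + wdist T y • z)) - (wdist T x - wdist T y) • z := by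
    module
  have h3 : ‖(wdist T x - wdist T y) • z‖ ≤ dist x y * a := by
    rw [norm_smul, Real.norm_eq_abs]
    exact mul_le_mul (abs_wdist_sub_le T x y) hz (norm_nonneg _) dist_nonneg
  have h4 := norm_sub_le (x + wdist T x • z - (y + wdist T y • z))
    ((wdist T x - wdist T y) • z)
  rw [← h2, ← dist_eq_norm, ← dist_eq_norm] at h4
  linarith

theorem abs_wdist_add_smul_sub_le {d : ℕ} (T : Set (EuclideanSpace ℝ (Fin d))) {a : ℝ}
    {z : EuclideanSpace ℝ (Fin d)} (hz : ‖z‖ ≤ a) (x : EuclideanSpace ℝ (Fin d)) :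
    |wdist T (x + wdist T x • z) - wdist T x| ≤ a * wdist T x := by
  refine (abs_wdist_sub_le T _ _).trans ?_
  rw [dist_self_add_left, norm_smul, Real.norm_of_nonneg (wdist_nonneg T x), mul_comm]
  exact mul_le_mul_of_nonneg_right hz (wdist_nonneg T x)

theorem ENNReal.ofReal_rpow_le_of_comparable {c u v : ℝ} (hc0 : 0 < c) (hu : 0 < u) (hv : 0 < v)
    (huv : c * u ≤ v) (hvu : c * v ≤ u) (t : ℝ) :
    ENNReal.ofReal u ^ t ≤ ENNReal.ofReal (c⁻¹ ^ |t|) * ENNReal.ofReal v ^ t := by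
  rw [ENNReal.ofReal_rpow_of_pos hu, ENNReal.ofReal_rpow_of_pos hv,
    ← ENNReal.ofReal_mul (by positivity)]
  refine ENNReal.ofReal_le_ofReal ?_
  rcases le_total 0 t with ht | ht
  · rw [abs_of_nonneg ht, ← Real.mul_rpow (inv_nonneg.2 hc0.le) hv.le, inv_mul_eq_div]
    exact Real.rpow_le_rpow hu.le ((le_div_iff₀' hc0).2 huv) ht
  · rw [abs_of_nonpos ht, Real.inv_rpow hc0.le, Real.rpow_neg hc0.le, inv_inv,
      ← Real.mul_rpow hc0.le hv.le]
    exact Real.rpow_le_rpow_of_nonpos (by positivity) hvu ht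

/-- Changing the aperture of Whitney balls, for integrals that are not normalized. -/
theorem exists_lintegral_whitney_ball_le (d : ℕ) {a b p : ℝ} (ha0 : 0 < a) (ha1 : a < 1)
    (hb0 : 0 < b) (hp : 0 < p) (t : ℝ) :
    ∃ C : ℝ≥0∞, C ≠ ∞ ∧ ∀ T : Set (EuclideanSpace ℝ (Fin d)), IsOpen T → Tᶜ.Nonempty →
      ∀ g : EuclideanSpace ℝ (Fin d) → ℝ≥0∞, Measurable g →
        ∫⁻ x in T, (∫⁻ y in ball x (a * wdist T x), g y) ^ p * ENNReal.ofReal (wdist T x) ^ t ≤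
          C * ∫⁻ x in T,
            (∫⁻ y in ball x (b * wdist T x), g y) ^ p * ENNReal.ofReal (wdist T x) ^ t := by
  have h1a : 0 < 1 - a := by linarith
  have hε : 0 < b * (1 - a) := mul_pos hb0 h1a
  obtain ⟨Z, hZa, hZfin, hZ⟩ :=
    (isCompact_closedBall (0 : EuclideanSpace ℝ (Fin d)) a).finite_cover_balls hε
  lift Z to Finset (EuclideanSpace ℝ (Fin d)) using hZfin
  set c : ℝ := (1 - a) / 2 with hc
  have hc0 : 0 < c := by positivity
  refine ⟨(Z.card : ℝ≥0∞) ^ p * ENNReal.ofReal (c⁻¹ ^ |t|) *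
    (Z.card * (((1 - a)⁻¹.toNNReal : NNReal) : ℝ≥0∞) ^ d), ?_, ?_⟩
  · finiteness
  intro T hT hTc g hg
  set G : EuclideanSpace ℝ (Fin d) → ℝ≥0∞ := T.indicator fun x =>
    (∫⁻ y in ball x (b * wdist T x), g y) ^ p * ENNReal.ofReal (wdist T x) ^ t with hG
  have hGm : Measurable G :=
    (((measurable_setLIntegral_ball ((measurable_wdist T).const_mul b) hg).pow_const p).mul
      ((measurable_wdist T).ennreal_ofReal.pow_const t)).indicator hT.measurableSet
  have hzn : ∀ z ∈ Z, ‖z‖ ≤ a := fun z hz => by simpa using hZa hz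
  have hΦm : ∀ z, Measurable fun x => x + wdist T x • z := fun z =>
    measurable_id.add ((measurable_wdist T).smul_const z)
  have key : ∀ x ∈ T,
      (∫⁻ y in ball x (a * wdist T x), g y) ^ p * ENNReal.ofReal (wdist T x) ^ t ≤
        (Z.card : ℝ≥0∞) ^ p * ENNReal.ofReal (c⁻¹ ^ |t|) *
          ∑ z ∈ Z, G (x + wdist T x • z) := by
    intro x hx
    have hD := wdist_pos hT hTc hx
    have hcmp : ∀ z ∈ Z, (1 - a) * wdist T x ≤ wdist T (x + wdist T x • z) ∧
        wdist T (x + wdist T x • z) ≤ (1 + a) * wdist T x := fun z hz => by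
      have := abs_le.1 (abs_wdist_add_smul_sub_le T (hzn z hz) x)
      constructor <;> linarith [this.1, this.2]
    have hcov : ball x (a * wdist T x) ⊆ ⋃ z ∈ Z,
        ball (x + wdist T x • z) (b * wdist T (x + wdist T x • z)) := by
      intro y hy
      have hw : (wdist T x)⁻¹ • (y - x) ∈ closedBall (0 : EuclideanSpace ℝ (Fin d)) a := by
        rw [mem_closedBall_zero_iff, norm_smul, norm_inv, Real.norm_of_nonneg hD.le,
          inv_mul_eq_div, div_le_iff₀ hD, ← dist_eq_norm]
        exact (mem_ball.1 hy).le
      obtain ⟨z, hz, hwz⟩ := mem_iUnion₂.1 (hZ hw)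
      refine mem_iUnion₂.2 ⟨z, hz, ?_⟩
      have hyz : y - (x + wdist T x • z) =
          wdist T x • ((wdist T x)⁻¹ • (y - x) - z) := by
        rw [smul_sub, smul_inv_smul₀ hD.ne']
        abel
      rw [mem_ball, dist_eq_norm] at hwz ⊢
      rw [hyz, norm_smul, Real.norm_of_nonneg hD.le]
      calc wdist T x * ‖(wdist T x)⁻¹ • (y - x) - z‖ < wdist T x * (b * (1 - a)) := by gcongr
        _ = b * ((1 - a) * wdist T x) := by ring
        _ ≤ _ := by gcongr; exact (hcmp z hz).1
    calc (∫⁻ y in ball x (a * wdist T x), g y) ^ p * ENNReal.ofReal (wdist T x) ^ t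
        ≤ (∑ z ∈ Z, ∫⁻ y in ball (x + wdist T x • z)
            (b * wdist T (x + wdist T x • z)), g y) ^ p * ENNReal.ofReal (wdist T x) ^ t := by
          gcongr
          exact (lintegral_mono_set hcov).trans (setLIntegral_biUnion_finset_le _ _ _)
      _ ≤ ((Z.card : ℝ≥0∞) ^ p * ∑ z ∈ Z, (∫⁻ y in ball (x + wdist T x • z)
            (b * wdist T (x + wdist T x • z)), g y) ^ p) * ENNReal.ofReal (wdist T x) ^ t := by
          gcongr
          exact ENNReal.sum_rpow_le_card_rpow_mul_sum_rpow _ _ hp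
      _ ≤ _ := by
          rw [mul_assoc, mul_assoc]
          refine mul_le_mul_right ?_ _
          rw [Finset.sum_mul, Finset.mul_sum]
          refine Finset.sum_le_sum fun z hz => ?_
          obtain ⟨hl, hu⟩ := hcmp z hz
          have hpos : 0 < wdist T (x + wdist T x • z) := (mul_pos h1a hD).trans_le hl
          have hmem : x + wdist T x • z ∈ T := by
            by_contra hn
            exact hpos.ne' (infDist_zero_of_mem hn)
          rw [hG, indicator_of_mem hmem, mul_left_comm]
          gcongr
          refine ENNReal.ofReal_rpow_le_of_comparable hc0 hD hpos ?_ ?_ t <;>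
            rw [hc] <;> nlinarith
  calc _ ≤ ∫⁻ x in T, (Z.card : ℝ≥0∞) ^ p * ENNReal.ofReal (c⁻¹ ^ |t|) *
          ∑ z ∈ Z, G (x + wdist T x • z) := setLIntegral_mono' hT.measurableSet key
    _ ≤ ∫⁻ x, (Z.card : ℝ≥0∞) ^ p * ENNReal.ofReal (c⁻¹ ^ |t|) *
          ∑ z ∈ Z, G (x + wdist T x • z) := setLIntegral_le_lintegral _ _
    _ = (Z.card : ℝ≥0∞) ^ p * ENNReal.ofReal (c⁻¹ ^ |t|) *
          ∑ z ∈ Z, ∫⁻ x, G (x + wdist T x • z) := by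
        have hGΦ : ∀ z ∈ Z, Measurable fun x => G (x + wdist T x • z) := fun z _ =>
          hGm.comp (hΦm z)
        rw [lintegral_const_mul _ (Finset.measurable_fun_sum _ hGΦ), lintegral_finsetSum _ hGΦ]
    _ ≤ (Z.card : ℝ≥0∞) ^ p * ENNReal.ofReal (c⁻¹ ^ |t|) *
          ∑ z ∈ Z, (((1 - a)⁻¹.toNNReal : NNReal) : ℝ≥0∞) ^ d * ∫⁻ x, G x := by
        gcongr with z hz
        exact (antilipschitzWith_add_wdist_smul T ha1 (hzn z hz)).lintegral_comp_le (hΦm z) hGm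
    _ = _ := by
        rw [Finset.sum_const, nsmul_eq_mul, hG, lintegral_indicator hT.measurableSet]
        ring

/-- The integral of normalized averages over Whitney balls of aperture `a`. -/
def whitneyAverage {d : ℕ} (a p s : ℝ) (T : Set (EuclideanSpace ℝ (Fin d)))
    (g : EuclideanSpace ℝ (Fin d) → ℝ≥0∞) : ℝ≥0∞ :=
  ∫⁻ x in T, ((volume (ball x (a * wdist T x)))⁻¹ * ∫⁻ y in ball x (a * wdist T x), g y) ^ p *
    ENNReal.ofReal (wdist T x) ^ s

theorem exists_whitneyAverage_eq (d : ℕ) {a p : ℝ} (ha0 : 0 < a) (hp : 0 < p) (s : ℝ) :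
    ∃ k : ℝ≥0∞, k ≠ 0 ∧ k ≠ ∞ ∧ ∀ T : Set (EuclideanSpace ℝ (Fin d)), IsOpen T → Tᶜ.Nonempty →
      ∀ g : EuclideanSpace ℝ (Fin d) → ℝ≥0∞,
        whitneyAverage a p s T g = k * ∫⁻ x in T,
          (∫⁻ y in ball x (a * wdist T x), g y) ^ p *
            ENNReal.ofReal (wdist T x) ^ (s - d * p) := by
  have hv0 : volume (ball (0 : EuclideanSpace ℝ (Fin d)) a) ≠ 0 := (measure_ball_pos _ _ ha0).ne'
  have hvt : volume (ball (0 : EuclideanSpace ℝ (Fin d)) a) ≠ ∞ := measure_ball_lt_top.ne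
  have hk : ((volume (ball (0 : EuclideanSpace ℝ (Fin d)) a))⁻¹) ^ p ≠ ∞ :=
    ENNReal.rpow_ne_top_of_nonneg hp.le (ENNReal.inv_ne_top.2 hv0)
  refine ⟨((volume (ball (0 : EuclideanSpace ℝ (Fin d)) a))⁻¹) ^ p, ?_, hk, ?_⟩
  · simp [ENNReal.rpow_eq_zero_iff, hvt, hv0, hp.not_gt]
  intro T hT hTc g
  rw [whitneyAverage, ← lintegral_const_mul' _ _ hk]
  refine setLIntegral_congr_fun hT.measurableSet fun x hx => ?_
  have hD := wdist_pos hT hTc hx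
  have hD0 : ENNReal.ofReal (wdist T x) ≠ 0 := (ENNReal.ofReal_pos.2 hD).ne'
  have hvol : volume (ball x (a * wdist T x)) =
      ENNReal.ofReal (wdist T x) ^ d * volume (ball (0 : EuclideanSpace ℝ (Fin d)) a) := by
    rw [mul_comm a, Measure.addHaar_ball_mul_of_pos _ _ hD, finrank_euclideanSpace_fin,
      ENNReal.ofReal_pow hD.le]
  have hpow : ((ENNReal.ofReal (wdist T x) ^ d)⁻¹) ^ p * ENNReal.ofReal (wdist T x) ^ s =
      ENNReal.ofReal (wdist T x) ^ (s - d * p) := by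
    rw [sub_eq_neg_add, ENNReal.rpow_add _ _ hD0 ENNReal.ofReal_ne_top, ENNReal.rpow_neg,
      ENNReal.rpow_mul, ENNReal.rpow_natCast, ENNReal.inv_rpow]
  beta_reduce
  rw [hvol, ENNReal.mul_inv (Or.inr hvt) (Or.inr hv0), ENNReal.mul_rpow_of_nonneg _ _ hp.le,
    ENNReal.mul_rpow_of_nonneg _ _ hp.le, ← hpow]
  ring

theorem exists_whitneyAverage_le (d : ℕ) {a b p : ℝ} (ha0 : 0 < a) (ha1 : a < 1)
    (hb0 : 0 < b) (hp : 0 < p) (s : ℝ) :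
    ∃ C : ℝ≥0∞, C ≠ ∞ ∧ ∀ T : Set (EuclideanSpace ℝ (Fin d)), IsOpen T → Tᶜ.Nonempty →
      ∀ g : EuclideanSpace ℝ (Fin d) → ℝ≥0∞, Measurable g →
        whitneyAverage a p s T g ≤ C * whitneyAverage b p s T g := by
  obtain ⟨k, -, hkt, hk⟩ := exists_whitneyAverage_eq d ha0 hp s
  obtain ⟨l, hl0, hlt, hl⟩ := exists_whitneyAverage_eq d hb0 hp s
  obtain ⟨C, hCt, hC⟩ := exists_lintegral_whitney_ball_le d ha0 ha1 hb0 hp (s - d * p)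
  refine ⟨k * C * l⁻¹, by finiteness, fun T hT hTc g hg => ?_⟩
  rw [hk T hT hTc, hl T hT hTc, ← mul_assoc, mul_assoc _ l⁻¹ l, ENNReal.inv_mul_cancel hl0 hlt,
    mul_one, mul_assoc]
  gcongr
  exact hC T hT hTc g hg

theorem avNorm_rpow_eq_whitneyAverage {d : ℕ} {F : Type*} [NormedAddCommGroup F] {q : ℝ}
    (hq : 0 < q) (σ : ℝ) (T : Set (EuclideanSpace ℝ (Fin d)))
    (H : EuclideanSpace ℝ (Fin d) → F) :
    avNorm q σ T H ^ q =
      whitneyAverage (1 / 2) (q / 2) (q - 1 - q * σ) T fun y => (‖H y‖₊ : ℝ≥0∞) ^ (2 : ℕ) := by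
  rw [avNorm, ← ENNReal.rpow_mul, one_div_mul_cancel hq.ne', ENNReal.rpow_one, whitneyAverage]
  simp_rw [one_div_mul_eq_div]

theorem averaged_norm_aperture_comparable (d : ℕ) (hd : 1 ≤ d) (a q σ : ℝ)
    (ha0 : 0 < a) (ha1 : a < 1) (hq0 : 0 < q) :
    ∃ C : ℝ, 1 < C ∧
      ∀ T : Set (EuclideanSpace ℝ (Fin d)), IsOpen T → Tᶜ.Nonempty →
        ∀ H : EuclideanSpace ℝ (Fin d) → ℝ, Measurable H →
          ENNReal.ofReal C⁻¹ * (avNorm q σ T H) ^ q ≤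
            (∫⁻ x in T,
              ((volume (Metric.ball x (a * wdist T x)))⁻¹ *
                  ∫⁻ y in Metric.ball x (a * wdist T x), (‖H y‖₊ : ℝ≥0∞) ^ (2 : ℕ)) ^ (q / 2) *
                ENNReal.ofReal (wdist T x) ^ (q - 1 - q * σ)) ∧
          (∫⁻ x in T,
              ((volume (Metric.ball x (a * wdist T x)))⁻¹ *
                  ∫⁻ y in Metric.ball x (a * wdist T x), (‖H y‖₊ : ℝ≥0∞) ^ (2 : ℕ)) ^ (q / 2) *
                ENNReal.ofReal (wdist T x) ^ (q - 1 - q * σ)) ≤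
            ENNReal.ofReal C * (avNorm q σ T H) ^ q := by
  obtain ⟨C₁, hC₁t, hC₁⟩ := exists_whitneyAverage_le d ha0 ha1 one_half_pos (half_pos hq0)
    (q - 1 - q * σ)
  obtain ⟨C₂, hC₂t, hC₂⟩ := exists_whitneyAverage_le d one_half_pos one_half_lt_one ha0
    (half_pos hq0) (q - 1 - q * σ)
  have h₁ := ENNReal.toReal_nonneg (a := C₁)
  have h₂ := ENNReal.toReal_nonneg (a := C₂)
  have hpos : 0 < C₁.toReal + C₂.toReal + 2 := by linarith
  refine ⟨C₁.toReal + C₂.toReal + 2, by linarith, fun T hT hTc H hH => ?_⟩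
  have hg : Measurable fun y => (‖H y‖₊ : ℝ≥0∞) ^ (2 : ℕ) := hH.nnnorm.coe_nnreal_ennreal.pow_const 2
  rw [avNorm_rpow_eq_whitneyAverage hq0]
  constructor
  · rw [ENNReal.ofReal_inv_of_pos hpos]
    refine (ENNReal.inv_mul_le_iff (ENNReal.ofReal_pos.2 hpos).ne' ENNReal.ofReal_ne_top).2 ?_
    refine (hC₂ T hT hTc _ hg).trans (mul_le_mul_left ?_ _)
    exact (ENNReal.le_ofReal_iff_toReal_le hC₂t hpos.le).2 (by linarith)
  · refine (hC₁ T hT hTc _ hg).trans (mul_le_mul_left ?_ _)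
    exact (ENNReal.le_ofReal_iff_toReal_le hC₁t hpos.le).2 (by linarith)
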